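/- For every δ ∈ (0,1] there exists N such that for every perfect square n ≥ N the following holds: there do not exist a nonempty subset C ⊆ A' and a subset B' ⊆ B with |B'| ≥ δ|B| such that C is (B',0.99)-closed. -/

import Mathlib

open Finset

/-- `B = {v ∈ F_2^n : |v| = √n}` (for `n = s²`). -/
def sphereB (n s : ℕ) : Finset (Fin n → ZMod 2) :=
  Finset.univ.filter (fun v => hammingNorm v = s)

noncomputable def sg (a : ZMod 2) : ℝ := if a = 0 then 1 else -1

lemma sg_add (a b : ZMod 2) : sg (a + b) = sg a * sg b := by
  have h : (1 + 1 : ZMod 2) = 0 := by decide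
  have hz : ∀ a : ZMod 2, a = 0 ∨ a = 1 := by decide
  rcases hz a with rfl | rfl <;> rcases hz b with rfl | rfl <;> simp [sg, h]

lemma sg_sq (a : ZMod 2) : sg a * sg a = 1 := by
  unfold sg; split_ifs <;> norm_num

lemma sg_abs (a : ZMod 2) : |sg a| = 1 := by
  unfold sg; split_ifs <;> norm_num

noncomputable def FF {n : ℕ} (c : Fin n → ZMod 2) : ℝ := ∑ i, sg (c i)

lemma FF_eq {n : ℕ} (c : Fin n → ZMod 2) : FF c = n - 2 * hammingNorm c := by
  unfold FF hammingNorm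
  have : ∀ i, sg (c i) = 1 - 2 * (if c i ≠ 0 then (1:ℝ) else 0) := by
    intro i; unfold sg; by_cases h : c i = 0 <;> simp [h]; norm_num
  simp_rw [this]
  rw [Finset.sum_sub_distrib, ← Finset.mul_sum, Finset.sum_boole]
  simp

lemma FF_abs {n : ℕ} (c : Fin n → ZMod 2) : |FF c| ≤ n := by
  unfold FF
  refine (Finset.abs_sum_le_sum_abs _ _).trans ?_
  simp [sg_abs]

lemma FF_mgf (n : ℕ) (θ : ℝ) :
    ∑ c : Fin n → ZMod 2, Real.exp (θ * FF c) = (Real.exp θ + Real.exp (-θ)) ^ n := by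
  have h1 : ∀ c : Fin n → ZMod 2, Real.exp (θ * FF c) = ∏ i, Real.exp (θ * sg (c i)) := by
    intro c; unfold FF; rw [Finset.mul_sum, Real.exp_sum]
  have h2 : ∑ a : ZMod 2, Real.exp (θ * sg a) = Real.exp θ + Real.exp (-θ) := by
    rw [show (Finset.univ : Finset (ZMod 2)) = {0, 1} by decide]
    rw [Finset.sum_pair (by decide)]
    simp [sg]
  have := Finset.prod_univ_sum (fun _ : Fin n => (Finset.univ : Finset (ZMod 2)))
    (fun _ a => Real.exp (θ * sg a))
  simp only [Fintype.piFinset_univ] at this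
  simp_rw [h1]
  rw [← this]
  simp [h2]

/-- walk step -/
noncomputable def sig {n s : ℕ} (x : Fin s → Fin n) : Fin n → ZMod 2 :=
  ∑ j, Pi.single (x j) 1

lemma sig_cons {n s : ℕ} (i : Fin n) (x : Fin s → Fin n) :
    sig (Fin.cons i x : Fin (s+1) → Fin n) = Pi.single i 1 + sig x := by
  unfold sig; rw [Fin.sum_univ_succ]; simp

lemma sum_cons {n s : ℕ} (f : (Fin (s+1) → Fin n) → ℝ) :
    ∑ x, f x = ∑ i, ∑ x : Fin s → Fin n, f (Fin.cons i x) := by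
  rw [← Fintype.sum_prod_type']
  exact (Fintype.sum_equiv (Fin.consEquiv (fun _ => Fin n)) _ _ (fun p => rfl)).symm

noncomputable def LL {n : ℕ} (h : (Fin n → ZMod 2) → ℝ) : (Fin n → ZMod 2) → ℝ :=
  fun z => ∑ i, h (z + Pi.single i 1)

lemma LL_iter {n : ℕ} (s : ℕ) : ∀ (h : (Fin n → ZMod 2) → ℝ) (z : Fin n → ZMod 2),
    (LL^[s]) h z = ∑ x : Fin s → Fin n, h (z + sig x) := by
  induction s with
  | zero => intro h z; simp [sig]
  | succ s ih =>
    intro h z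
    rw [Function.iterate_succ_apply, ih, sum_cons, Finset.sum_comm]
    refine Finset.sum_congr rfl fun x _ => Finset.sum_congr rfl fun i _ => ?_
    rw [sig_cons]; congr 1; abel

lemma sig_apply {n s : ℕ} (x : Fin s → Fin n) (hx : Function.Injective x) (i : Fin n) :
    sig x i = if i ∈ Finset.univ.image x then 1 else 0 := by
  unfold sig
  rw [Finset.sum_apply]
  simp only [Pi.single_apply]
  split_ifs with h
  · obtain ⟨j, -, rfl⟩ := Finset.mem_image.1 h
    simp [hx.eq_iff]
  · apply Finset.sum_eq_zero
    intro j _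
    rw [if_neg]
    rintro rfl
    exact h (Finset.mem_image_of_mem _ (Finset.mem_univ _))

lemma sig_norm {n s : ℕ} (x : Fin s → Fin n) (hx : Function.Injective x) :
    hammingNorm (sig x) = s := by
  unfold hammingNorm
  simp only [sig_apply x hx]
  have : (Finset.univ.filter fun i => (if i ∈ Finset.univ.image x then (1 : ZMod 2) else 0) ≠ 0)
      = Finset.univ.image x := by
    ext i; simp
  rw [this, Finset.card_image_of_injective _ hx]; simp

lemma sig_inj {n s : ℕ} (x : Fin s → Fin n) (hx : hammingNorm (sig x) = s) :
    Function.Injective x := by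
  have h1 : (Finset.univ.filter fun i => sig x i ≠ 0) ⊆ Finset.univ.image x := by
    intro i hi
    by_contra hc
    apply (Finset.mem_filter.1 hi).2
    unfold sig
    rw [Finset.sum_apply]
    apply Finset.sum_eq_zero
    intro j _
    rw [Pi.single_apply, if_neg]
    rintro rfl
    exact hc (Finset.mem_image_of_mem _ (Finset.mem_univ _))
  have h2 := Finset.card_le_card h1
  have h3 : s ≤ (Finset.univ.image x).card := by
    unfold hammingNorm at hx; omega
  have h4 : (Finset.univ.image x).card = (Finset.univ : Finset (Fin s)).card := by
    apply le_antisymm Finset.card_image_le; simpa using h3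
  have := Finset.card_image_iff.1 h4
  simpa [Set.injOn_univ] using this

lemma FF_step {n s : ℕ} (c : Fin n → ZMod 2) (x : Fin s → Fin n) (hx : Function.Injective x) :
    FF c - FF (c + sig x) = 2 * ∑ j, sg (c (x j)) := by
  unfold FF
  rw [← Finset.sum_sub_distrib]
  have : ∀ i, sg (c i) - sg ((c + sig x) i) =
      if i ∈ Finset.univ.image x then 2 * sg (c i) else 0 := by
    intro i
    rw [Pi.add_apply, sg_add, sig_apply x hx]
    split_ifs
    · have : sg 1 = -1 := by simp [sg]
      rw [this]; ring
    · simp [sg]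
  simp_rw [this]
  rw [Finset.sum_ite_mem, Finset.univ_inter, Finset.sum_image (fun a _ b _ h => hx h),
    Finset.mul_sum]

lemma fib_const {n s : ℕ} (w w' : Fin n → ZMod 2) (h : hammingNorm w = hammingNorm w') :
    (Finset.univ.filter fun x : Fin s → Fin n => sig x = w).card =
    (Finset.univ.filter fun x : Fin s → Fin n => sig x = w').card := by
  have hz : ∀ a : ZMod 2, a ≠ 0 → a = 1 := by decide
  have e0 : {i // w i ≠ 0} ≃ {i // w' i ≠ 0} := by
    apply Fintype.equivOfCardEq
    rw [Fintype.card_subtype, Fintype.card_subtype]; exact h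
  let π : Equiv.Perm (Fin n) := e0.extendSubtype
  have hπ : ∀ i, w' (π i) = w i := by
    intro i
    by_cases hi : w i ≠ 0
    · have := e0.extendSubtype_mem i hi
      rw [hz _ hi]; exact hz _ this
    · have := e0.extendSubtype_not_mem i hi
      push Not at hi this
      rw [hi]; exact this
  have hs : ∀ (x : Fin s → Fin n) i, sig (π ∘ x) (π i) = sig x i := by
    intro x i
    unfold sig
    simp [Finset.sum_apply, Pi.single_apply]
  refine Finset.card_equiv (Equiv.arrowCongr (Equiv.refl _) π) ?_
  intro x
  have hc : (Equiv.arrowCongr (Equiv.refl (Fin s)) π) x = π ∘ x := rfl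
  simp only [Finset.mem_filter, Finset.mem_univ, true_and, hc]
  constructor
  · intro hx; ext1 i
    obtain ⟨i, rfl⟩ := π.surjective i
    rw [hs, hπ, hx]
  · intro hx; ext1 i
    rw [← hs, ← hπ, hx]

lemma desc_bound (n k : ℕ) (hn : 0 < n) (hk : k * k ≤ n) :
    (n : ℝ) ^ k * (1 - k * (k - 1) / (2 * n)) ≤ (n.descFactorial k : ℝ) := by
  have hn' : (0:ℝ) < n := by exact_mod_cast hn
  induction k with
  | zero => simp
  | succ k ih =>
    have hk2 : k * k ≤ n := by nlinarith
    have hkn : k ≤ n := by nlinarith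
    have := ih hk2
    rw [Nat.descFactorial_succ, Nat.cast_mul, Nat.cast_sub hkn]
    have h1 : (0:ℝ) ≤ n - k := by rw [sub_nonneg]; exact_mod_cast hkn
    refine le_trans ?_ (mul_le_mul_of_nonneg_left this h1)
    have e : ((n:ℝ) - k) * (n ^ k * (1 - k * (k - 1) / (2 * n))) =
      n ^ (k+1) * ((1 - k / n) * (1 - k * (k - 1) / (2 * n))) := by
      field_simp; ring
    rw [e]
    apply mul_le_mul_of_nonneg_left _ (by positivity)
    push_cast
    have h2 : (0:ℝ) ≤ k / n * (k * (k - 1) / (2 * n)) := by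
      rcases Nat.eq_zero_or_pos k with h | h
      · simp [h]
      · have : (1:ℝ) ≤ k := by exact_mod_cast h
        have : (0:ℝ) ≤ k - 1 := by linarith
        positivity
    have h3 : ((k:ℝ) + 1) * (k + 1 - 1) / (2 * n) = k / n + k * (k - 1) / (2 * n) := by
      field_simp; ring
    rw [h3]; nlinarith

lemma second_moment1 {n : ℕ} (h : Fin n → ℝ) (h0 : ∑ i, h i = 0) (s : ℕ) :
    n * ∑ x : Fin s → Fin n, (∑ j, h (x j)) ^ 2 = s * n ^ s * ∑ i, h i ^ 2 := by
  induction s with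
  | zero => simp
  | succ s ih =>
    rw [sum_cons]
    have e : ∀ (i : Fin n) (x : Fin s → Fin n),
        (∑ j, h ((Fin.cons i x : Fin (s+1) → Fin n) j)) ^ 2 =
        h i ^ 2 + h i * (2 * ∑ j, h (x j)) + (∑ j, h (x j)) ^ 2 := by
      intro i x; rw [Fin.sum_univ_succ]; simp only [Fin.cons_zero, Fin.cons_succ]; ring
    simp_rw [e, Finset.sum_add_distrib, ← Finset.mul_sum, ← Finset.sum_mul, h0]
    simp only [Finset.sum_const, Finset.card_univ, Fintype.card_fin, Fintype.card_pi,
      Finset.prod_const, nsmul_eq_mul, ← Finset.mul_sum]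
    push_cast
    linear_combination n * ih

lemma second_moment2 {n : ℕ} (N : Fin n → Fin n → ℝ) (hs : ∀ a b, N a b = N b a)
    (h0 : ∀ b, ∑ a, N a b = 0) (s : ℕ) :
    n ^ 2 * ∑ x : Fin s → Fin n, (∑ j, ∑ l, N (x j) (x l) - ∑ j, N (x j) (x j)) ^ 2
      = 2 * s * (s - 1) * n ^ s * ∑ a, ∑ b, N a b ^ 2 := by
  induction s with
  | zero => simp
  | succ s ih =>
    rw [sum_cons]
    have e : ∀ (i : Fin n) (x : Fin s → Fin n),
        (∑ j, ∑ l, N ((Fin.cons i x : Fin (s+1) → Fin n) j) ((Fin.cons i x : Fin (s+1) → Fin n) l)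
          - ∑ j, N ((Fin.cons i x : Fin (s+1) → Fin n) j)
            ((Fin.cons i x : Fin (s+1) → Fin n) j)) ^ 2 =
        (∑ j, ∑ l, N (x j) (x l) - ∑ j, N (x j) (x j)) ^ 2
        + 4 * ((∑ j, ∑ l, N (x j) (x l) - ∑ j, N (x j) (x j)) * ∑ j, N i (x j))
        + 4 * (∑ j, N i (x j)) ^ 2 := by
      intro i x
      simp only [Fin.sum_univ_succ, Fin.cons_zero, Fin.cons_succ, Finset.sum_add_distrib]
      have : ∑ j, N (x j) i = ∑ j, N i (x j) := Finset.sum_congr rfl fun j _ => hs _ _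
      rw [this]; ring
    simp_rw [e, Finset.sum_add_distrib, ← Finset.mul_sum]
    have c0 : ∑ i, ∑ x : Fin s → Fin n,
      ((∑ j, ∑ l, N (x j) (x l) - ∑ j, N (x j) (x j)) * ∑ j, N i (x j)) = 0 := by
      rw [Finset.sum_comm]
      apply Finset.sum_eq_zero; intro x _
      have hz : ∑ i, ∑ j, N i (x j) = 0 := by rw [Finset.sum_comm]; simp [h0]
      rw [← Finset.mul_sum, hz, mul_zero]
    rw [c0]
    have c1 : n * ∑ i, ∑ x : Fin s → Fin n, (∑ j, N i (x j)) ^ 2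
        = s * n ^ s * ∑ a, ∑ b, N a b ^ 2 := by
      rw [Finset.mul_sum, Finset.mul_sum]
      refine Finset.sum_congr rfl fun i _ => second_moment1 (N i) ?_ s
      rw [← h0 i]; exact Finset.sum_congr rfl fun j _ => hs _ _
    simp only [Finset.sum_const, Finset.card_univ, Fintype.card_fin, nsmul_eq_mul]
    push_cast
    linear_combination n * ih + 4 * n * c1

/-- Fourier bound -/
noncomputable def chi {n : ℕ} (u z : Fin n → ZMod 2) : ℝ := ∏ i, sg (u i * z i)

lemma sg_zero : sg 0 = 1 := by simp [sg]

lemma chi_add {n : ℕ} (u z w : Fin n → ZMod 2) : chi u (z + w) = chi u z * chi u w := by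
  unfold chi; rw [← Finset.prod_mul_distrib]
  refine Finset.prod_congr rfl fun i _ => ?_
  rw [← sg_add, Pi.add_apply, mul_add]

lemma chi_single {n : ℕ} (u : Fin n → ZMod 2) (i : Fin n) :
    chi u (Pi.single i 1) = sg (u i) := by
  unfold chi
  rw [Finset.prod_eq_single i]
  · simp
  · intro j _ hj; simp [Pi.single_eq_of_ne hj, sg_zero]
  · simp

lemma chi_abs {n : ℕ} (u z : Fin n → ZMod 2) : |chi u z| = 1 := by
  unfold chi; rw [Finset.abs_prod]; simp [sg_abs]

lemma chi_sum {n : ℕ} (z : Fin n → ZMod 2) :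
    ∑ u, chi u z = if z = 0 then (2:ℝ) ^ n else 0 := by
  have h2 : ∀ b : ZMod 2, ∑ a : ZMod 2, sg (a * b) = if b = 0 then 2 else 0 := by
    intro b
    rw [show (Finset.univ : Finset (ZMod 2)) = {0, 1} by decide]
    rw [Finset.sum_pair (by decide)]
    simp [sg]; split_ifs <;> norm_num
  have := Finset.prod_univ_sum (fun _ : Fin n => (Finset.univ : Finset (ZMod 2)))
    (fun i a => sg (a * z i))
  simp only [Fintype.piFinset_univ] at this
  unfold chi
  rw [← this]
  simp_rw [h2]
  split_ifs with h
  · simp [h]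
  · obtain ⟨i, hi⟩ := Function.ne_iff.1 h
    exact Finset.prod_eq_zero (Finset.mem_univ i) (by simpa using hi)

lemma walk_count {n : ℕ} (m : ℕ) (z : Fin n → ZMod 2) :
    (2:ℝ) ^ n * ∑ x : Fin m → Fin n, (if z + sig x = 0 then (1:ℝ) else 0)
      = ∑ u, chi u z * FF u ^ m := by
  have h1 : ∀ x : Fin m → Fin n, (2:ℝ) ^ n * (if z + sig x = 0 then (1:ℝ) else 0)
      = ∑ u, chi u (z + sig x) := by
    intro x; rw [chi_sum]; split_ifs <;> simp
  rw [Finset.mul_sum]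
  simp_rw [h1]
  rw [Finset.sum_comm]
  refine Finset.sum_congr rfl fun u _ => ?_
  simp_rw [chi_add]
  rw [← Finset.mul_sum]
  congr 1
  have h3 := LL_iter m (chi u) 0
  have h4 : ∀ k, (LL^[k]) (chi u) = fun z => FF u ^ k * chi u z := by
    intro k
    induction k with
    | zero => simp
    | succ k ih =>
      rw [Function.iterate_succ_apply', ih]
      ext z
      unfold LL FF
      simp_rw [chi_add, chi_single]
      rw [← Finset.mul_sum, ← Finset.mul_sum]; ring
  rw [h4] at h3
  have h5 : chi u 0 = 1 := by simp [chi, sg_zero]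
  simp only [h5, zero_add, mul_one] at h3
  exact h3.symm

lemma walk_bound {n : ℕ} (hn : 0 < n) (m : ℕ) (z : Fin n → ZMod 2) :
    (2:ℝ) ^ n * ∑ x : Fin m → Fin n, (if z + sig x = 0 then (1:ℝ) else 0)
      ≤ 2 * n ^ m * Real.exp (n * Real.exp (-(2 * (m / n)))) := by
  have hn' : (0:ℝ) < n := by exact_mod_cast hn
  rw [walk_count]
  set θ : ℝ := m / n with hθ
  have hm : (m:ℝ) = θ * n := by rw [hθ]; field_simp
  have h1 : ∀ u : Fin n → ZMod 2, chi u z * FF u ^ m ≤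
      n ^ m * Real.exp (-m) * (Real.exp (θ * FF u) + Real.exp ((-θ) * FF u)) := by
    intro u
    have a1 : chi u z * FF u ^ m ≤ |FF u| ^ m := by
      refine (le_abs_self _).trans ?_
      rw [abs_mul, chi_abs, one_mul, abs_pow]
    have a2 : |FF u| / n ≤ Real.exp (|FF u| / n - 1) := by
      have := Real.add_one_le_exp (|FF u| / n - 1); linarith
    have a3 : (|FF u| / n) ^ m ≤ Real.exp (θ * |FF u| - m) := by
      refine (pow_le_pow_left₀ (by positivity) a2 m).trans ?_
      rw [← Real.exp_nat_mul]
      apply le_of_eq; congr 1; rw [hθ]; ring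
    have a4 : Real.exp (θ * |FF u|) ≤ Real.exp (θ * FF u) + Real.exp ((-θ) * FF u) := by
      rcases abs_cases (FF u) with ⟨h, _⟩ | ⟨h, _⟩
      · rw [h]; have := Real.exp_pos ((-θ) * FF u); linarith
      · rw [h, mul_neg, ← neg_mul]; have := Real.exp_pos (θ * FF u); linarith
    have a5 : |FF u| ^ m = n ^ m * (|FF u| / n) ^ m := by
      rw [← mul_pow]; congr 1; field_simp
    rw [a5] at a1
    refine a1.trans ?_
    rw [mul_assoc]
    apply mul_le_mul_of_nonneg_left _ (by positivity)
    refine a3.trans ?_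
    rw [sub_eq_add_neg, Real.exp_add, mul_comm]
    exact mul_le_mul_of_nonneg_left a4 (Real.exp_pos _).le
  refine (Finset.sum_le_sum fun u _ => h1 u).trans ?_
  rw [← Finset.mul_sum, Finset.sum_add_distrib, FF_mgf, FF_mgf, neg_neg]
  have e1 : (Real.exp θ + Real.exp (-θ)) = Real.exp θ * (1 + Real.exp (-(2*θ))) := by
    rw [mul_add, ← Real.exp_add]; ring_nf
  have e2 : Real.exp (-m) * Real.exp θ ^ n = 1 := by
    rw [← Real.exp_nat_mul, ← Real.exp_add, hm]
    rw [show -(θ * n) + n * θ = 0 by ring, Real.exp_zero]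
  have e3 : (1 + Real.exp (-(2*θ))) ^ n ≤ Real.exp (n * Real.exp (-(2 * θ))) := by
    rw [Real.exp_nat_mul]
    apply pow_le_pow_left₀ (by positivity)
    have := Real.add_one_le_exp (Real.exp (-(2*θ))); linarith
  rw [add_comm (Real.exp (-θ)), e1, mul_pow]
  calc _ = 2 * n ^ m * (Real.exp (-m) * Real.exp θ ^ n) * (1 + Real.exp (-(2*θ))) ^ n := by ring
    _ ≤ _ := by
      rw [e2, mul_one]
      exact mul_le_mul_of_nonneg_left e3 (by positivity)

lemma chernoff {n : ℕ} (C : Finset (Fin n → ZMod 2)) (c0 : Fin n → ZMod 2) (ε : ℝ) (hε : 0 < ε) :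
    ∑ c ∈ C, FF (c + c0) ^ 2 ≤
      n ^ 2 * (C.card * ε ^ 2 + 2 * 2 ^ n * Real.exp (-(ε ^ 2 * n / 2))) := by
  have h1 : ∀ c : Fin n → ZMod 2, FF c ^ 2 ≤ n ^ 2 * ε ^ 2 + n ^ 2 * (Real.exp (-(ε^2 * n)) *
      (Real.exp (ε * FF c) + Real.exp ((-ε) * FF c))) := by
    intro c
    have hp : 0 ≤ Real.exp (-(ε^2 * n)) *
      (Real.exp (ε * FF c) + Real.exp ((-ε) * FF c)) := by positivity
    by_cases h : |FF c| ≤ ε * n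
    · have : FF c ^ 2 ≤ (ε * n) ^ 2 := by
        rw [← sq_abs]; exact pow_le_pow_left₀ (abs_nonneg _) h 2
      nlinarith [mul_nonneg (sq_nonneg (n:ℝ)) hp]
    · push Not at h
      have a1 : FF c ^ 2 ≤ n ^ 2 := by
        rw [← sq_abs]; exact pow_le_pow_left₀ (abs_nonneg _) (FF_abs c) 2
      have a4 : Real.exp (ε * |FF c|) ≤ Real.exp (ε * FF c) + Real.exp ((-ε) * FF c) := by
        rcases abs_cases (FF c) with ⟨h, _⟩ | ⟨h, _⟩
        · rw [h]; have := Real.exp_pos ((-ε) * FF c); linarith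
        · rw [h, mul_neg, ← neg_mul]; have := Real.exp_pos (ε * FF c); linarith
      have a5 : 1 ≤ Real.exp (-(ε^2 * n)) *
          (Real.exp (ε * FF c) + Real.exp ((-ε) * FF c)) := by
        refine le_trans ?_ (mul_le_mul_of_nonneg_left a4 (Real.exp_pos _).le)
        rw [← Real.exp_add]
        apply Real.one_le_exp
        nlinarith
      have : 0 ≤ (n:ℝ)^2 * ε^2 := by positivity
      nlinarith [mul_le_mul_of_nonneg_left a5 (sq_nonneg (n:ℝ))]
  refine (Finset.sum_le_sum fun c _ => h1 (c + c0)).trans ?_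
  rw [Finset.sum_add_distrib, Finset.sum_const, nsmul_eq_mul, ← Finset.mul_sum, ← Finset.mul_sum]
  have h2 : ∑ c ∈ C, (Real.exp (ε * FF (c + c0)) + Real.exp ((-ε) * FF (c + c0)))
      ≤ 2 * 2 ^ n * Real.exp (ε ^ 2 * n / 2) := by
    refine (Finset.sum_le_sum_of_subset_of_nonneg (Finset.subset_univ C)
      (fun _ _ _ => by positivity)).trans ?_
    rw [(Fintype.sum_equiv (Equiv.addRight c0)
      (fun c => (Real.exp (ε * FF (c + c0)) + Real.exp ((-ε) * FF (c + c0))))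
      (fun c => (Real.exp (ε * FF c) + Real.exp ((-ε) * FF c))) (fun c => rfl))]
    rw [Finset.sum_add_distrib, FF_mgf, FF_mgf, neg_neg, add_comm (Real.exp (-ε)), ← two_mul]
    have : Real.exp ε + Real.exp (-ε) ≤ 2 * Real.exp (ε ^ 2 / 2) := by
      have := Real.cosh_le_exp_half_sq ε
      rw [Real.cosh_eq] at this; linarith
    rw [mul_assoc]
    apply mul_le_mul_of_nonneg_left _ (by norm_num)
    refine (pow_le_pow_left₀ (by positivity) this n).trans ?_
    rw [mul_pow, ← Real.exp_nat_mul]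
    apply le_of_eq; congr 2; ring
  have h3 : Real.exp (-(ε^2 * n)) * Real.exp (ε ^ 2 * n / 2) = Real.exp (-(ε ^ 2 * n / 2)) := by
    rw [← Real.exp_add]; congr 1; ring
  rw [← h3]
  have := mul_le_mul_of_nonneg_left (mul_le_mul_of_nonneg_left h2 (Real.exp_pos (-(ε^2 * n))).le)
    (sq_nonneg (n:ℝ))
  nlinarith

lemma vadd_self {n : ℕ} (w : Fin n → ZMod 2) : w + w = 0 := by
  ext1 i; exact CharTwo.add_self_eq_zero (w i)

lemma vadd_cancel {n : ℕ} (z w : Fin n → ZMod 2) : z + w + w = z := by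
  rw [add_assoc, vadd_self, add_zero]

lemma exists_q (n s : ℕ) : ∃ q : ℕ, ∀ w ∈ sphereB n s,
    (Finset.univ.filter fun x : Fin s → Fin n => sig x = w).card = q := by
  by_cases h : (sphereB n s).Nonempty
  · obtain ⟨w0, h0⟩ := h
    refine ⟨_, fun w hw => fib_const w w0 ?_⟩
    simp only [sphereB, Finset.mem_filter] at h0 hw
    rw [h0.2, hw.2]
  · exact ⟨0, fun w hw => (h ⟨w, hw⟩).elim⟩

noncomputable def XX {n : ℕ} (s : ℕ) (B' : Finset (Fin n → ZMod 2)) : Finset (Fin s → Fin n) :=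
  Finset.univ.filter fun x => sig x ∈ B'

lemma sum_XX {n s q : ℕ} (hq : ∀ w ∈ sphereB n s,
    (Finset.univ.filter fun x : Fin s → Fin n => sig x = w).card = q)
    (B' : Finset (Fin n → ZMod 2)) (hB : B' ⊆ sphereB n s) (h : (Fin n → ZMod 2) → ℝ) :
    ∑ x ∈ XX s B', h (sig x) = q * ∑ w ∈ B', h w := by
  rw [← Finset.sum_fiberwise_of_maps_to (s := XX s B') (t := B') (g := sig)
    (fun x hx => (Finset.mem_filter.1 hx).2), Finset.mul_sum]
  refine Finset.sum_congr rfl fun w hw => ?_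
  have : (XX s B').filter (fun x => sig x = w) = Finset.univ.filter fun x => sig x = w := by
    ext x; simp only [XX, Finset.mem_filter, Finset.mem_univ, true_and]
    constructor
    · exact fun h => h.2
    · exact fun h => ⟨h ▸ hw, h⟩
  rw [this, ← hq w (hB hw), ← nsmul_eq_mul, ← Finset.sum_const]
  refine Finset.sum_congr rfl fun x hx => ?_
  rw [(Finset.mem_filter.1 hx).2]

lemma card_XX {n s q : ℕ} (hq : ∀ w ∈ sphereB n s,
    (Finset.univ.filter fun x : Fin s → Fin n => sig x = w).card = q)
    (B' : Finset (Fin n → ZMod 2)) (hB : B' ⊆ sphereB n s) :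
    ((XX s B').card : ℝ) = q * B'.card := by
  have := sum_XX hq B' hB (fun _ => 1)
  simpa using this

lemma XX_large {n s q : ℕ} (hn : n = s ^ 2) (hs : 0 < s) (hq : ∀ w ∈ sphereB n s,
    (Finset.univ.filter fun x : Fin s → Fin n => sig x = w).card = q)
    (B' : Finset (Fin n → ZMod 2)) (hB : B' ⊆ sphereB n s) (δ : ℝ) (hδ : 0 < δ)
    (hd : δ * (sphereB n s).card ≤ B'.card) :
    δ / 2 * n ^ s ≤ q * B'.card := by
  have h1 := card_XX hq (sphereB n s) subset_rfl
  have h2 : n.descFactorial s ≤ (XX s (sphereB n s)).card := by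
    have : Fintype.card (Fin s ↪ Fin n) = n.descFactorial s := by
      rw [Fintype.card_embedding_eq]; simp
    rw [← this, ← Finset.card_univ]
    apply Finset.card_le_card_of_injOn (fun e : Fin s ↪ Fin n => (e : Fin s → Fin n))
    · intro e _
      simp only [XX, sphereB, Finset.coe_filter, Finset.mem_filter, Finset.mem_univ, true_and,
        Set.mem_ofPred_eq]
      exact sig_norm _ e.injective
    · intro a _ b _ h
      exact DFunLike.coe_injective h
  have hn0 : 0 < n := by rw [hn]; positivity
  have h3 := desc_bound n s hn0 (by rw [hn]; nlinarith)
  have hn' : (0:ℝ) < n := by exact_mod_cast hn0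
  have hs' : (0:ℝ) < s := by exact_mod_cast hs
  have hns : (n:ℝ) = s ^ 2 := by rw [hn]; push_cast; rfl
  have h4 : (1:ℝ) / 2 ≤ 1 - s * (s - 1) / (2 * n) := by
    have : (s:ℝ) * (s - 1) / (2 * n) ≤ 1 / 2 := by
      rw [div_le_div_iff₀ (by positivity) (by norm_num), hns]; nlinarith
    linarith
  have h5 : (n:ℝ) ^ s * (1 / 2) ≤ q * (sphereB n s).card := by
    rw [← h1]
    refine (mul_le_mul_of_nonneg_left h4 (by positivity)).trans (h3.trans ?_)
    exact_mod_cast h2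
  have h6 := mul_le_mul_of_nonneg_left hd (Nat.cast_nonneg (α := ℝ) q)
  nlinarith [mul_le_mul_of_nonneg_left h5 hδ.le]

noncomputable def TT {n : ℕ} (B' : Finset (Fin n → ZMod 2)) (h : (Fin n → ZMod 2) → ℝ) :
    (Fin n → ZMod 2) → ℝ := fun z => ∑ w ∈ B', h (z + w)

lemma TT_symm {n : ℕ} (B' : Finset (Fin n → ZMod 2)) (g h : (Fin n → ZMod 2) → ℝ) :
    ∑ z, g z * TT B' h z = ∑ z, TT B' g z * h z := by
  unfold TT
  simp_rw [Finset.mul_sum, Finset.sum_mul]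
  rw [Finset.sum_comm, Finset.sum_comm (s := Finset.univ)]
  refine Finset.sum_congr rfl fun w _ => ?_
  refine Fintype.sum_equiv (Equiv.addRight w) _ _ fun z => ?_
  simp [vadd_cancel]

lemma TT_symm_iter {n : ℕ} (B' : Finset (Fin n → ZMod 2)) (k : ℕ) :
    ∀ (g h : (Fin n → ZMod 2) → ℝ),
    ∑ z, g z * ((TT B')^[k]) h z = ∑ z, ((TT B')^[k]) g z * h z := by
  induction k with
  | zero => intro g h; rfl
  | succ k ih =>
    intro g h
    rw [Function.iterate_succ_apply', TT_symm, ih, ← Function.iterate_succ_apply]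

noncomputable def ind {n : ℕ} (C : Finset (Fin n → ZMod 2)) : (Fin n → ZMod 2) → ℝ :=
  fun z => if z ∈ C then 1 else 0

lemma sum_ind_mul {n : ℕ} (C : Finset (Fin n → ZMod 2)) (h : (Fin n → ZMod 2) → ℝ) :
    ∑ z, ind C z * h z = ∑ z ∈ C, h z := by
  unfold ind; simp

lemma pow_lower {n : ℕ} (C B' : Finset (Fin n → ZMod 2)) (hC : C.Nonempty)
    (hcl : (0.99 : ℝ) * C.card * B'.card ≤
            (((C ×ˢ B').filter (fun p => p.1 + p.2 ∈ C)).card : ℝ)) (j : ℕ) :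
    (C.card : ℝ) * (0.99 * B'.card) ^ (2 ^ j) ≤ ∑ c ∈ C, ((TT B')^[2 ^ j]) (ind C) c := by
  have hc : (0:ℝ) < C.card := by exact_mod_cast hC.card_pos
  induction j with
  | zero =>
    have : ∑ c ∈ C, ((TT B')^[2 ^ 0]) (ind C) c =
        (((C ×ˢ B').filter (fun p => p.1 + p.2 ∈ C)).card : ℝ) := by
      rw [Finset.card_filter, Finset.sum_product]
      push_cast
      simp [TT, ind]
    rw [this]; refine le_trans (le_of_eq ?_) hcl; simp; ring
  | succ j ih =>
    have h1 : ∑ c ∈ C, ((TT B')^[2 ^ (j+1)]) (ind C) c =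
        ∑ z, (((TT B')^[2 ^ j]) (ind C) z) ^ 2 := by
      rw [← sum_ind_mul, pow_succ, mul_two, Function.iterate_add_apply, TT_symm_iter]
      simp_rw [sq]
    have h2 : ∑ c ∈ C, (((TT B')^[2 ^ j]) (ind C) c) ^ 2 ≤
        ∑ z, (((TT B')^[2 ^ j]) (ind C) z) ^ 2 :=
      Finset.sum_le_sum_of_subset_of_nonneg (Finset.subset_univ C) fun _ _ _ => sq_nonneg _
    have h3 := sq_sum_le_card_mul_sum_sq (s := C) (f := ((TT B')^[2 ^ j]) (ind C))
    rw [h1]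
    refine le_trans ?_ h2
    have h4 := pow_le_pow_left₀ (by positivity) ih 2
    have h5 := h4.trans h3
    rw [pow_succ, pow_mul]
    have : (C.card:ℝ) * ((C.card : ℝ) * ((0.99 * B'.card) ^ (2 ^ j)) ^ 2) ≤
      C.card * ∑ c ∈ C, (((TT B')^[2 ^ j]) (ind C) c) ^ 2 := by
      refine le_trans (le_of_eq ?_) h5; ring
    exact le_of_mul_le_mul_left this hc

lemma TT_mono {n : ℕ} (B' : Finset (Fin n → ZMod 2)) {g h : (Fin n → ZMod 2) → ℝ}
    (H : ∀ z, g z ≤ h z) (z) : TT B' g z ≤ TT B' h z :=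
  Finset.sum_le_sum fun _ _ => H _

lemma pow_upper {n s q : ℕ} (hq : ∀ w ∈ sphereB n s,
    (Finset.univ.filter fun x : Fin s → Fin n => sig x = w).card = q)
    (B' : Finset (Fin n → ZMod 2)) (hB : B' ⊆ sphereB n s)
    (h : (Fin n → ZMod 2) → ℝ) (h0 : ∀ z, 0 ≤ h z) (k : ℕ) :
    ∀ z, (q:ℝ) ^ k * ((TT B')^[k]) h z ≤ (LL^[s * k]) h z := by
  have hpos : ∀ m z, 0 ≤ (LL^[m]) h z := by
    intro m z; rw [LL_iter]; exact Finset.sum_nonneg fun _ _ => h0 _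
  have hone : ∀ g : (Fin n → ZMod 2) → ℝ, (∀ z, 0 ≤ g z) → ∀ z,
      q * TT B' g z ≤ (LL^[s]) g z := by
    intro g hg z
    rw [LL_iter]
    unfold TT
    rw [← sum_XX hq B' hB (fun w => g (z + w))]
    exact Finset.sum_le_sum_of_subset_of_nonneg (Finset.subset_univ _) fun _ _ _ => hg _
  induction k with
  | zero => intro z; simp
  | succ k ih =>
    intro z
    rw [Function.iterate_succ_apply', Nat.mul_succ, add_comm (s * k) s, Function.iterate_add_apply]
    refine le_trans ?_ (hone _ (hpos _) z)
    have := TT_mono B' ih z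
    have e : TT B' (fun z => (q:ℝ) ^ k * ((TT B')^[k]) h z) z =
        (q:ℝ) ^ k * TT B' (((TT B')^[k]) h) z := by
      unfold TT; rw [Finset.mul_sum]
    rw [e] at this
    rw [pow_succ]
    nlinarith [mul_le_mul_of_nonneg_left this (Nat.cast_nonneg (α := ℝ) q)]

lemma density {n s q : ℕ} (hn : n = s ^ 2) (hs : 0 < s) (hq : ∀ w ∈ sphereB n s,
    (Finset.univ.filter fun x : Fin s → Fin n => sig x = w).card = q)
    (C B' : Finset (Fin n → ZMod 2)) (hC : C.Nonempty)
    (hB : B' ⊆ sphereB n s) (δ : ℝ) (hδ : 0 < δ)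
    (hd : δ * (sphereB n s).card ≤ B'.card)
    (hcl : (0.99 : ℝ) * C.card * B'.card ≤
            (((C ×ˢ B').filter (fun p => p.1 + p.2 ∈ C)).card : ℝ)) (j : ℕ) :
    (δ / 4) ^ (2 ^ j) * 2 ^ n ≤
      2 * C.card * Real.exp (n * Real.exp (-(2 * ((2 ^ j : ℕ) / s)))) := by
  have hc : (0:ℝ) < C.card := by exact_mod_cast hC.card_pos
  have hs' : (0:ℝ) < s := by exact_mod_cast hs
  have hn0 : 0 < n := by rw [hn]; positivity
  have hn' : (0:ℝ) < n := by exact_mod_cast hn0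
  have hns : (n:ℝ) = s ^ 2 := by rw [hn]; push_cast; rfl
  have h1 := pow_lower C B' hC hcl j
  set k := 2 ^ j with hk
  have h2 : (q:ℝ) ^ k * ∑ c ∈ C, ((TT B')^[k]) (ind C) c ≤ ∑ c ∈ C, (LL^[s * k]) (ind C) c := by
    rw [Finset.mul_sum]
    refine Finset.sum_le_sum fun c _ => pow_upper hq B' hB (ind C) ?_ k c
    intro z; unfold ind; split_ifs <;> norm_num
  have e0 : ((s * k : ℕ) : ℝ) / n = k / s := by
    rw [hns]; push_cast; field_simp
  have h3 : ∀ c ∈ C, 2 ^ n * (LL^[s * k]) (ind C) c ≤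
      C.card * (2 * n ^ (s * k) * Real.exp (n * Real.exp (-(2 * (k / s))))) := by
    intro c _
    rw [LL_iter]
    have e1 : ∀ z, ind C z = ∑ c' ∈ C, if z + c' = 0 then (1:ℝ) else 0 := by
      intro z
      have : ∀ c', z + c' = 0 ↔ z = c' := by
        intro c'
        constructor
        · intro h; rw [← vadd_cancel z c', h, zero_add]
        · rintro rfl; exact vadd_self _
      simp [this, ind]
    simp_rw [e1]
    rw [Finset.sum_comm, Finset.mul_sum, ← nsmul_eq_mul, ← Finset.sum_const]
    refine Finset.sum_le_sum fun c' _ => ?_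
    have := walk_bound hn0 (s * k) (c + c')
    rw [e0] at this
    refine le_trans (le_of_eq ?_) this
    simp_rw [add_right_comm]
  have h4 := Finset.sum_le_sum h3
  rw [← Finset.mul_sum, Finset.sum_const, nsmul_eq_mul] at h4
  have h5 := XX_large hn hs hq B' hB δ hδ hd
  have h6 : (δ / 4 * n ^ s) ^ k ≤ (q * (0.99 * B'.card)) ^ k := by
    apply pow_le_pow_left₀ (by positivity)
    have : (0:ℝ) ≤ δ * n ^ s := by positivity
    nlinarith
  set E := Real.exp (n * Real.exp (-(2 * (k / s : ℝ))))
  have h7 : (C.card * n ^ (s * k)) * ((δ / 4) ^ k * 2 ^ n) ≤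
      (C.card * n ^ (s * k)) * (2 * C.card * E) := by
    calc (C.card * (n:ℝ) ^ (s * k)) * ((δ / 4) ^ k * 2 ^ n)
        = 2 ^ n * (C.card * (δ / 4 * n ^ s) ^ k) := by rw [mul_pow, ← pow_mul]; ring
      _ ≤ 2 ^ n * (C.card * (q * (0.99 * B'.card)) ^ k) := by gcongr
      _ = 2 ^ n * (q ^ k * (C.card * (0.99 * B'.card) ^ k)) := by rw [mul_pow]; ring
      _ ≤ 2 ^ n * (q ^ k * ∑ c ∈ C, ((TT B')^[k]) (ind C) c) := by gcongr
      _ ≤ 2 ^ n * ∑ c ∈ C, (LL^[s * k]) (ind C) c := by gcongr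
      _ ≤ _ := h4
      _ = _ := by ring
  exact le_of_mul_le_mul_left h7 (by positivity)

lemma main_moment {n s : ℕ} (hn : n = s ^ 2) (hs : 0 < s) (C : Finset (Fin n → ZMod 2))
    (X : Finset (Fin s → Fin n)) (δ : ℝ) (hδ : 0 < δ)
    (hX : δ / 2 * n ^ s ≤ X.card)
    (hF : ∀ c0, ∑ c ∈ C, FF (c + c0) ^ 2 ≤ C.card * (2 * (δ / 32)) * n ^ 2) :
    ∑ x ∈ X, ∑ c ∈ C, (∑ j, sg (c (x j)) - FF c / s) ^ 2 ≤ 5 * s * C.card * X.card := by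
  have hs' : (0:ℝ) < s := by exact_mod_cast hs
  have hn0 : 0 < n := by rw [hn]; positivity
  have hn' : (0:ℝ) < n := by exact_mod_cast hn0
  have hns : (n:ℝ) = s ^ 2 := by rw [hn]; push_cast; rfl
  set G : (Fin n → ZMod 2) → Fin n → ℝ := fun c i => sg (c i) - FF c / n with hG
  have G0 : ∀ c, ∑ i, G c i = 0 := by
    intro c
    simp only [hG, Finset.sum_sub_distrib, Finset.sum_const, Finset.card_univ, Fintype.card_fin,
      nsmul_eq_mul]
    rw [mul_div_cancel₀ _ hn'.ne']; simp [FF]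
  have G4 : ∀ c i, G c i * G c i ≤ 4 := by
    intro c i
    have h1 : |G c i| ≤ 2 := by
      have a : |FF c / n| ≤ 1 := by
        rw [abs_div, Nat.abs_cast, div_le_one hn']; exact FF_abs c
      have := abs_sub (sg (c i)) (FF c / n)
      rw [sg_abs] at this
      simp only [hG]; linarith
    have := abs_le.1 h1
    nlinarith
  have Gs : ∀ c (x : Fin s → Fin n), ∑ j, sg (c (x j)) - FF c / s = ∑ j, G c (x j) := by
    intro c x
    simp only [hG, Finset.sum_sub_distrib, Finset.sum_const, Finset.card_univ, Fintype.card_fin,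
      nsmul_eq_mul]
    rw [hns]; field_simp
  have GG : ∀ c c', ∑ a, G c a * G c' a = FF (c + c') - FF c * FF c' / n := by
    intro c c'
    have e : ∀ a, G c a * G c' a = sg ((c + c') a) - FF c' / n * sg (c a) - FF c / n * G c' a := by
      intro a; simp only [hG, Pi.add_apply, sg_add]; ring
    simp_rw [e, Finset.sum_sub_distrib, ← Finset.mul_sum, G0]
    simp only [FF]; ring
  set N : Fin n → Fin n → ℝ := fun a b => ∑ c ∈ C, G c a * G c b with hN
  have Nsymm : ∀ a b, N a b = N b a := by
    intro a b; simp only [hN]; exact Finset.sum_congr rfl fun c _ => mul_comm _ _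
  have N0 : ∀ b, ∑ a, N a b = 0 := by
    intro b; simp only [hN]; rw [Finset.sum_comm]
    apply Finset.sum_eq_zero; intro c _
    rw [← Finset.sum_mul, G0, zero_mul]
  have HS : ∑ a, ∑ b, N a b ^ 2 ≤ 8 * (δ / 32) * n ^ 2 * C.card ^ 2 := by
    have e : ∑ a, ∑ b, N a b ^ 2 = ∑ c ∈ C, ∑ c' ∈ C, (∑ a, G c a * G c' a) ^ 2 := by
      have e1 : ∀ a b, N a b ^ 2 = ∑ c ∈ C, ∑ c' ∈ C, (G c a * G c b) * (G c' a * G c' b) := by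
        intro a b; rw [sq]; simp only [hN]; rw [Finset.sum_mul_sum]
      have e2 : ∀ c c', (∑ a, G c a * G c' a) ^ 2 =
          ∑ a, ∑ b, (G c a * G c b) * (G c' a * G c' b) := by
        intro c c'; rw [sq, Finset.sum_mul_sum]
        exact Finset.sum_congr rfl fun a _ => Finset.sum_congr rfl fun b _ => by ring
      simp_rw [e1, e2]
      calc _ = ∑ a, ∑ c ∈ C, ∑ b, ∑ c' ∈ C, (G c a * G c b) * (G c' a * G c' b) :=
            Finset.sum_congr rfl fun a _ => Finset.sum_comm
        _ = ∑ c ∈ C, ∑ a, ∑ b, ∑ c' ∈ C, (G c a * G c b) * (G c' a * G c' b) := Finset.sum_comm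
        _ = ∑ c ∈ C, ∑ a, ∑ c' ∈ C, ∑ b, (G c a * G c b) * (G c' a * G c' b) :=
            Finset.sum_congr rfl fun c _ => Finset.sum_congr rfl fun a _ => Finset.sum_comm
        _ = _ := Finset.sum_congr rfl fun c _ => Finset.sum_comm
    rw [e]
    have b1 : ∀ c ∈ C, ∑ c' ∈ C, (∑ a, G c a * G c' a) ^ 2 ≤
        8 * (δ / 32) * n ^ 2 * C.card := by
      intro c _
      have b2 : ∀ c' ∈ C, (∑ a, G c a * G c' a) ^ 2 ≤
          2 * FF (c' + c) ^ 2 + 2 * FF (c' + 0) ^ 2 := by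
        intro c' _
        rw [GG, add_comm c c', add_zero]
        have : (FF c * FF c' / n) ^ 2 ≤ FF c' ^ 2 := by
          rw [mul_comm, mul_div_assoc, mul_pow]
          have a : |FF c / n| ≤ 1 := by
            rw [abs_div, Nat.abs_cast, div_le_one hn']; exact FF_abs c
          have : (FF c / n) ^ 2 ≤ 1 := by rw [← sq_abs]; exact pow_le_one₀ (abs_nonneg _) a
          nlinarith [sq_nonneg (FF c')]
        nlinarith [sq_nonneg (FF (c' + c) + FF c * FF c' / n)]
      refine (Finset.sum_le_sum b2).trans ?_
      rw [Finset.sum_add_distrib, ← Finset.mul_sum, ← Finset.mul_sum]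
      nlinarith [hF c, hF 0]
    refine (Finset.sum_le_sum b1).trans (le_of_eq ?_)
    rw [Finset.sum_const, nsmul_eq_mul]; ring
  set Y : (Fin s → Fin n) → ℝ := fun x => ∑ j, ∑ l, N (x j) (x l) - ∑ j, N (x j) (x j) with hY
  have Ysq := second_moment2 N Nsymm N0 s
  have Ysum : ∑ x ∈ X, Y x ≤ s * C.card * X.card := by
    refine le_trans (le_abs_self _) (abs_le_of_sq_le_sq ?_ (by positivity))
    refine (sq_sum_le_card_mul_sum_sq (s := X) (f := Y)).trans ?_
    have y1 : ∑ x ∈ X, Y x ^ 2 ≤ ∑ x, Y x ^ 2 :=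
      Finset.sum_le_sum_of_subset_of_nonneg (Finset.subset_univ X) fun _ _ _ => sq_nonneg _
    have y2 : (n:ℝ) ^ 2 * ∑ x, Y x ^ 2 ≤ (n:ℝ) ^ 2 * (s ^ 2 * C.card ^ 2 * X.card) := by
      simp only [hY]
      rw [Ysq]
      calc 2 * (s:ℝ) * (s - 1) * n ^ s * ∑ a, ∑ b, N a b ^ 2
          ≤ 2 * s * s * n ^ s * ∑ a, ∑ b, N a b ^ 2 := by
            have : 0 ≤ ∑ a, ∑ b, N a b ^ 2 :=
              Finset.sum_nonneg fun _ _ => Finset.sum_nonneg fun _ _ => sq_nonneg _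
            gcongr; linarith
        _ ≤ 2 * s * s * n ^ s * (8 * (δ / 32) * n ^ 2 * C.card ^ 2) := by gcongr
        _ = (n ^ 2 * s ^ 2 * C.card ^ 2) * (δ / 2 * n ^ s) := by ring
        _ ≤ (n ^ 2 * s ^ 2 * C.card ^ 2) * X.card := by gcongr
        _ = _ := by ring
    have y3 := le_of_mul_le_mul_left y2 (by positivity)
    have := mul_le_mul_of_nonneg_left (y1.trans y3) (Nat.cast_nonneg (α := ℝ) X.card)
    refine this.trans (le_of_eq ?_); ring
  have pt : ∀ x, ∑ c ∈ C, (∑ j, sg (c (x j)) - FF c / s) ^ 2 ≤ Y x + 4 * s * C.card := by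
    intro x
    have e1 : ∑ c ∈ C, (∑ j, sg (c (x j)) - FF c / s) ^ 2 = ∑ j, ∑ l, N (x j) (x l) := by
      simp_rw [Gs, sq, Finset.sum_mul_sum]
      simp only [hN]
      rw [Finset.sum_comm]
      exact Finset.sum_congr rfl fun j _ => Finset.sum_comm
    have e2 : ∑ j, N (x j) (x j) ≤ 4 * s * C.card := by
      have : ∀ a, N a a ≤ 4 * C.card := by
        intro a; simp only [hN]
        refine (Finset.sum_le_sum fun c _ => G4 c a).trans (le_of_eq ?_)
        rw [Finset.sum_const, nsmul_eq_mul]; ring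
      refine (Finset.sum_le_sum fun j _ => this (x j)).trans (le_of_eq ?_)
      simp; ring
    rw [e1]; simp only [hY]; linarith
  refine (Finset.sum_le_sum fun x _ => pt x).trans ?_
  rw [Finset.sum_add_distrib, Finset.sum_const, nsmul_eq_mul]
  nlinarith

lemma final_contra {n s q : ℕ} (hn : n = s ^ 2) (hs : 0 < s) (hq : ∀ w ∈ sphereB n s,
    (Finset.univ.filter fun x : Fin s → Fin n => sig x = w).card = q)
    (C B' : Finset (Fin n → ZMod 2)) (hC : C.Nonempty)
    (hA : ∀ v ∈ C, (hammingNorm v : ℝ) ≤ n / 2 - 10 ^ 15 * (n : ℝ) ^ ((3 : ℝ) / 4))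
    (hB : B' ⊆ sphereB n s) (hP : (0:ℝ) < (XX s B').card)
    (hcl : (0.99 : ℝ) * C.card * B'.card ≤
            (((C ×ˢ B').filter (fun p => p.1 + p.2 ∈ C)).card : ℝ))
    (hM : ∑ x ∈ XX s B', ∑ c ∈ C, (∑ j, sg (c (x j)) - FF c / s) ^ 2
      ≤ 5 * s * C.card * (XX s B').card) : False := by
  have hs' : (0:ℝ) < s := by exact_mod_cast hs
  have hc : (0:ℝ) < C.card := by exact_mod_cast hC.card_pos
  have hns : (n:ℝ) = s ^ 2 := by rw [hn]; push_cast; rfl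
  obtain ⟨r, hr, hrs⟩ : ∃ r : ℝ, 0 < r ∧ (s:ℝ) = r ^ 2 :=
    ⟨Real.sqrt s, Real.sqrt_pos.2 hs', (Real.sq_sqrt hs'.le).symm⟩
  have hpow : (n : ℝ) ^ ((3 : ℝ) / 4) = r ^ 3 := by
    rw [hns, hrs, ← pow_mul, ← Real.rpow_natCast, ← Real.rpow_mul hr.le, ← Real.rpow_natCast r 3]
    norm_num
  set X := XX s B' with hXdef
  set Good := (C ×ˢ X).filter (fun p => p.1 + sig p.2 ∈ C) with hGood
  have hinj : ∀ x ∈ X, Function.Injective x := by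
    intro x hx
    have h1 := hB (Finset.mem_filter.1 hx).2
    exact sig_inj x (Finset.mem_filter.1 h1).2
  have hmem : ∀ p ∈ Good, p.1 ∈ C ∧ p.2 ∈ X ∧ p.1 + sig p.2 ∈ C := by
    intro p hp
    have h1 := Finset.mem_filter.1 hp
    have h2 := Finset.mem_product.1 h1.1
    exact ⟨h2.1, h2.2, h1.2⟩
  have hcard : (Good.card : ℝ) = q * (((C ×ˢ B').filter (fun p => p.1 + p.2 ∈ C)).card : ℝ) := by
    have := sum_XX hq B' hB (fun w => ∑ c ∈ C, if c + w ∈ C then (1:ℝ) else 0)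
    rw [hGood, Finset.card_filter, Finset.card_filter, Finset.sum_product_right,
      Finset.sum_product_right]
    push_cast
    exact this
  have hXc := card_XX hq B' hB
  have hG99 : 0.99 * C.card * X.card ≤ (Good.card : ℝ) := by
    rw [hcard, hXc]
    nlinarith [mul_le_mul_of_nonneg_left hcl (Nat.cast_nonneg (α := ℝ) q)]
  have hGle : (Good.card : ℝ) ≤ C.card * X.card := by
    have := Finset.card_filter_le (C ×ˢ X) (fun p => p.1 + sig p.2 ∈ C)
    rw [Finset.card_product] at this
    exact_mod_cast this
  have hbal : ∑ p ∈ Good, FF (p.1 + sig p.2) = ∑ p ∈ Good, FF p.1 := by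
    have hmap : ∀ p ∈ Good, (p.1 + sig p.2, p.2) ∈ Good := by
      intro p hp
      obtain ⟨a, b, c⟩ := hmem p hp
      rw [hGood, Finset.mem_filter, Finset.mem_product]
      refine ⟨⟨c, b⟩, ?_⟩
      simp only [vadd_cancel]; exact a
    refine Finset.sum_nbij' (fun p => (p.1 + sig p.2, p.2)) (fun p => (p.1 + sig p.2, p.2))
      hmap hmap ?_ ?_ ?_
    · intro p _; simp only [vadd_cancel]
    · intro p _; simp only [vadd_cancel]
    · intro p _; rfl
  have hzero : ∑ p ∈ Good, ∑ j, sg (p.1 (p.2 j)) = 0 := by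
    have : ∑ p ∈ Good, (2 * ∑ j, sg (p.1 (p.2 j))) = 0 := by
      rw [← sub_eq_zero.2 hbal.symm, ← Finset.sum_sub_distrib]
      exact Finset.sum_congr rfl fun p hp => (FF_step _ _ (hinj _ (hmem p hp).2.1)).symm
    rw [← Finset.mul_sum] at this; linarith
  set D : (Fin n → ZMod 2) × (Fin s → Fin n) → ℝ :=
    fun p => ∑ j, sg (p.1 (p.2 j)) - FF p.1 / s with hD
  have hD2 : ∑ p ∈ Good, D p ^ 2 ≤ 5 * s * C.card * X.card := by
    refine le_trans ?_ hM
    rw [← Finset.sum_product_right (s := C) (t := X) (f := fun p => D p ^ 2)]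
    exact Finset.sum_le_sum_of_subset_of_nonneg (Finset.filter_subset _ _) fun _ _ _ => sq_nonneg _
  have hCS := sq_sum_le_card_mul_sum_sq (s := Good) (f := D)
  have hDb : |∑ p ∈ Good, D p| ≤ 3 * r * (C.card * X.card) := by
    apply abs_le_of_sq_le_sq _ (by positivity)
    refine hCS.trans ?_
    refine (mul_le_mul hGle hD2 (Finset.sum_nonneg fun _ _ => sq_nonneg _) (by positivity)).trans ?_
    rw [hrs]
    have : 0 ≤ (r * (C.card * X.card)) ^ 2 := by positivity
    nlinarith
  have hFl : ∀ p ∈ Good, 2 * 10 ^ 15 * r ≤ FF p.1 / s := by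
    intro p hp
    have := hA _ (hmem p hp).1
    rw [hpow] at this
    rw [FF_eq, le_div_iff₀ hs', hrs]
    nlinarith
  have hsum : ∑ p ∈ Good, D p + ∑ p ∈ Good, FF p.1 / s = 0 := by
    rw [← Finset.sum_add_distrib, ← hzero]
    exact Finset.sum_congr rfl fun p _ => by simp [hD]
  have hlow := Finset.card_nsmul_le_sum Good (fun p => FF p.1 / s) _ hFl
  rw [nsmul_eq_mul] at hlow
  have hd1 := (abs_le.1 hDb).1
  have hpos : 0 < r * (C.card * X.card) := by positivity
  have := mul_le_mul_of_nonneg_right hG99 (by positivity : 0 ≤ 2 * 10 ^ 15 * r)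
  nlinarith

set_option maxHeartbeats 1000000 in
theorem stmt15 (δ : ℝ) (hδ₀ : 0 < δ) (hδ₁ : δ ≤ 1) :
    ∃ N : ℕ, ∀ n s : ℕ, n = s ^ 2 → N ≤ n →
      ¬ ∃ (C : Finset (Fin n → ZMod 2)) (B' : Finset (Fin n → ZMod 2)),
          C.Nonempty ∧
          (∀ v ∈ C, (hammingNorm v : ℝ) ≤ n / 2 - 10 ^ 15 * (n : ℝ) ^ ((3 : ℝ) / 4)) ∧
          B' ⊆ sphereB n s ∧
          δ * (sphereB n s).card ≤ (B'.card : ℝ) ∧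
          (0.99 : ℝ) * C.card * B'.card ≤
            (((C ×ˢ B').filter (fun p => p.1 + p.2 ∈ C)).card : ℝ) := by
  obtain ⟨ε, hε, hε2⟩ : ∃ ε : ℝ, 0 < ε ∧ ε ^ 2 = δ / 32 :=
    ⟨Real.sqrt (δ / 32), Real.sqrt_pos.2 (by positivity), Real.sq_sqrt (by positivity)⟩
  obtain ⟨A, hA⟩ := exists_nat_ge (4 / ε ^ 2)
  have hApos : (0:ℝ) < A := lt_of_lt_of_le (by positivity) hA
  have hA1 : 0 < A := by exact_mod_cast hApos
  have hAexp : Real.exp (-(2 * A : ℝ)) ≤ ε ^ 2 / 4 := by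
    rw [Real.exp_neg]
    have h1 : 4 / ε ^ 2 ≤ Real.exp (2 * A) := by
      have := Real.add_one_le_exp (2 * (A:ℝ)); linarith
    have := inv_anti₀ (by positivity) h1
    rwa [inv_div] at this
  set Λ := Real.log (4 / δ) with hΛ
  have hΛ0 : 0 ≤ Λ := Real.log_nonneg (by rw [le_div_iff₀ hδ₀]; linarith)
  set M := Real.log (4 / ε ^ 2) with hM
  have hM0 : 0 ≤ M := Real.log_nonneg (by rw [le_div_iff₀ (by positivity), hε2]; linarith)
  obtain ⟨s0, hs0⟩ := exists_nat_ge (4 * (2 * A * Λ + M) / ε ^ 2)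
  refine ⟨(s0 + 1) ^ 2, ?_⟩
  rintro n s hn hNn ⟨C, B', hC, hAA, hB, hd, hcl⟩
  have hss : s0 + 1 ≤ s := by
    rw [hn] at hNn
    exact (Nat.pow_le_pow_iff_left (by norm_num)).1 hNn
  have hs : 0 < s := by omega
  have hs' : (0:ℝ) < s := by exact_mod_cast hs
  have hs1 : (1:ℝ) ≤ s := by exact_mod_cast hs
  have hn0 : 0 < n := by rw [hn]; positivity
  have hn' : (0:ℝ) < n := by exact_mod_cast hn0
  have hns : (n:ℝ) = s ^ 2 := by rw [hn]; push_cast; rfl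
  have hc : (0:ℝ) < C.card := by exact_mod_cast hC.card_pos
  have hs0s : 4 * (2 * A * Λ + M) / ε ^ 2 ≤ s := by
    refine hs0.trans ?_
    have : s0 ≤ s := by omega
    exact_mod_cast this
  obtain ⟨q, hq⟩ := exists_q n s
  have hX := XX_large hn hs hq B' hB δ hδ₀ hd
  rw [← card_XX hq B' hB] at hX
  have hP : (0:ℝ) < (XX s B').card := lt_of_lt_of_le (by positivity) hX
  refine final_contra hn hs hq C B' hC hAA hB hP hcl (main_moment hn hs C _ δ hδ₀ hX ?_)
  intro c0
  refine (chernoff C c0 ε hε).trans ?_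
  obtain ⟨j, hj1, hj2⟩ := exists_nat_pow_near (x := A * s) (y := 2) (by nlinarith) (by norm_num)
  have hden := density hn hs hq C B' hC hB δ hδ₀ hd hcl (j + 1)
  set k := 2 ^ (j + 1) with hk
  have hk1 : (A:ℝ) * s ≤ k := by exact_mod_cast hj2.le
  have hk2 : (k:ℝ) ≤ 2 * A * s := by
    have : k ≤ 2 * A * s := by rw [hk, pow_succ]; nlinarith
    exact_mod_cast this
  have h1 : Real.exp (-(2 * ((k:ℝ) / s))) ≤ ε ^ 2 / 4 := by
    refine le_trans (Real.exp_le_exp.2 ?_) hAexp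
    have : (A:ℝ) ≤ k / s := by rw [le_div_iff₀ hs']; exact hk1
    linarith
  have h2 : Real.exp (-(2 * A * s * Λ)) ≤ (δ / 4) ^ k := by
    have : δ / 4 = Real.exp (-Λ) := by
      rw [hΛ, Real.exp_neg, Real.exp_log (by positivity), inv_div]
    rw [this, ← Real.exp_nat_mul]
    apply Real.exp_le_exp.2
    nlinarith
  have h3 : Real.exp (-(2 * A * s * Λ)) * 2 ^ n ≤ 2 * C.card * Real.exp (n * (ε ^ 2 / 4)) := by
    refine (mul_le_mul_of_nonneg_right h2 (by positivity)).trans (hden.trans ?_)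
    gcongr
  have h4 : (2:ℝ) ^ n ≤ 2 * C.card * Real.exp (n * (ε ^ 2 / 4) + 2 * A * s * Λ) := by
    have := mul_le_mul_of_nonneg_left h3 (Real.exp_pos (2 * A * s * Λ)).le
    rw [← mul_assoc, ← Real.exp_add, add_neg_cancel, Real.exp_zero, one_mul] at this
    rw [Real.exp_add]; linarith
  have h5 : 4 * Real.exp (n * (ε ^ 2 / 4) + 2 * A * s * Λ - ε ^ 2 * n / 2) ≤ ε ^ 2 := by
    have : n * (ε ^ 2 / 4) + 2 * A * s * Λ - ε ^ 2 * n / 2 ≤ -M := by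
      rw [div_le_iff₀ (by positivity)] at hs0s
      have := mul_le_mul_of_nonneg_right hs0s hs'.le
      rw [hns]
      nlinarith
    have h6 := Real.exp_le_exp.2 this
    rw [hM, Real.exp_neg, Real.exp_log (by positivity), inv_div] at h6
    linarith
  have h7 : 2 * 2 ^ n * Real.exp (-(ε ^ 2 * n / 2)) ≤ C.card * ε ^ 2 := by
    calc 2 * 2 ^ n * Real.exp (-(ε ^ 2 * n / 2))
        ≤ 2 * (2 * C.card * Real.exp (n * (ε ^ 2 / 4) + 2 * A * s * Λ)) *
          Real.exp (-(ε ^ 2 * n / 2)) := by gcongr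
      _ = C.card * (4 * Real.exp (n * (ε ^ 2 / 4) + 2 * A * s * Λ - ε ^ 2 * n / 2)) := by
          rw [sub_eq_add_neg, Real.exp_add _ (-(ε ^ 2 * n / 2))]; ring
      _ ≤ _ := by gcongr
  rw [← hε2]
  have : (0:ℝ) ≤ n ^ 2 := by positivity
  nlinarith [mul_le_mul_of_nonneg_left h7 this]
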